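/- Let α be an element of the set {1,3,4,6,7,9,11,12,14,15,20,22,23,27,28,30,31,36,38,39,46,47,54,55,63}, and write α = 9j + t with integers j ≥ 0 and 0 ≤ t ≤ 8. Then for all integers n ≥ 0 and k ≥ 0, the number a_{3α+2}(3^{2k+3} n + 9^k(18 + t) + α(9^k − 1)/8) is divisible by 3. (Here 9^k ≡ 1 (mod 8), so α(9^k − 1)/8 is an integer.) -/

import Mathlib

/-- `a k n` is the number of partitions of `n` in which each odd part may appear in any
of `k` colors and even parts appear in at most one color: equivalently, the number of
`k`-tuples `(λ_0, …, λ_{k-1})` of partitions where `λ_0` is an ordinary partition,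
`λ_1, …, λ_{k-1}` are partitions into odd parts, and the sums of their parts add up to `n`.
Each partition is recorded as a multiset of positive parts. -/
noncomputable def coloredPartition (k n : ℕ) : ℕ :=
  Set.ncard {c : Fin k → Multiset ℕ |
    (∀ i, ∀ x ∈ c i, 0 < x) ∧
    (∀ i : Fin k, i.val ≠ 0 → ∀ x ∈ c i, Odd x) ∧
    (∑ i, (c i).sum) = n}

open PowerSeries

/-- Section of a power series. -/
noncomputable def cpU (r : ℕ) (f : PowerSeries (ZMod 3)) : PowerSeries (ZMod 3) :=
  PowerSeries.mk fun n => coeff (3 * n + r) f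

lemma cp_cube (f : PowerSeries (ZMod 3)) : f ^ 3 = PowerSeries.expand 3 (by norm_num) f := by
  have h := MvPowerSeries.map_frobenius_expand (σ := Unit) (R := ZMod 3) 3 (by norm_num) (f := f)
  rw [ZMod.frobenius_zmod] at h
  rw [MvPowerSeries.map_id] at h
  exact h.symm

lemma cpU_add (r : ℕ) (f g : PowerSeries (ZMod 3)) : cpU r (f + g) = cpU r f + cpU r g := by
  ext n; simp [cpU]

lemma cp_decomp (f : PowerSeries (ZMod 3)) :
    f = (cpU 0 f) ^ 3 + X * (cpU 1 f) ^ 3 + X ^ 2 * (cpU 2 f) ^ 3 := by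
  ext n
  rw [cp_cube, cp_cube, cp_cube]
  obtain ⟨m, hm | hm | hm⟩ : ∃ m, n = 3 * m ∨ n = 3 * m + 1 ∨ n = 3 * m + 2 :=
    ⟨n / 3, by omega⟩
  · subst hm
    rw [map_add, map_add]
    rcases m with _ | m
    · simp [coeff_expand, cpU, coeff_X_pow_mul']
    · rw [show 3 * (m+1) = (3 * m + 2) + 1 by ring, coeff_succ_X_mul, coeff_X_pow_mul']
      simp only [coeff_expand, cpU, coeff_mk]
      rw [if_pos (by omega), if_neg (by omega), if_pos (by omega), if_neg (by omega)]
      rw [show (3 * m + 2 + 1) / 3 = m + 1 by omega]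
      simp; ring_nf
  · subst hm
    rw [map_add, map_add, coeff_succ_X_mul, coeff_X_pow_mul']
    simp only [coeff_expand, cpU, coeff_mk]
    rw [if_neg (by omega), if_pos (by omega)]
    rw [show (3 * m) / 3 = m by omega]
    split_ifs <;> first | omega | simp
  · subst hm
    rw [map_add, map_add, show 3 * m + 2 = (3 * m + 1) + 1 by ring, coeff_succ_X_mul,
      coeff_X_pow_mul']
    simp only [coeff_expand, cpU, coeff_mk]
    rw [if_neg (by omega), if_neg (by omega), if_pos (by omega), if_pos (by omega)]
    rw [show (3 * m + 1 + 1 - 2) / 3 = m by omega]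
    simp

lemma cpU_basic (g : PowerSeries (ZMod 3)) (r s : ℕ) (hr : r < 3) (hs : s < 3) :
    cpU r (X ^ s * g ^ 3) = if r = s then g else 0 := by
  ext n
  rw [cp_cube, cpU, coeff_mk, coeff_X_pow_mul', coeff_expand]
  by_cases h : r = s
  · subst h
    rw [if_pos (by omega), if_pos (by omega), if_pos rfl, show (3 * n + r - r) / 3 = n by omega]
  · rw [if_neg h]
    split_ifs <;> first | omega | simp

lemma cpU_comb (a b c : PowerSeries (ZMod 3)) (r : ℕ) (hr : r < 3) :
    cpU r (a ^ 3 + X * b ^ 3 + X ^ 2 * c ^ 3) = if r = 0 then a else if r = 1 then b else c := by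
  have h0 := cpU_basic a r 0 hr (by norm_num)
  have h1 := cpU_basic b r 1 hr (by norm_num)
  have h2 := cpU_basic c r 2 hr (by norm_num)
  rw [pow_zero, one_mul] at h0
  rw [pow_one] at h1
  rw [cpU_add, cpU_add, h0, h1, h2]
  interval_cases r <;> simp

lemma cpU_cube_mul (g f : PowerSeries (ZMod 3)) (r : ℕ) (hr : r < 3) :
    cpU r (g ^ 3 * f) = g * cpU r f := by
  conv_lhs => rw [cp_decomp f]
  rw [show g ^ 3 * ((cpU 0 f) ^ 3 + X * (cpU 1 f) ^ 3 + X ^ 2 * (cpU 2 f) ^ 3) =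
    (g * cpU 0 f) ^ 3 + X * (g * cpU 1 f) ^ 3 + X ^ 2 * (g * cpU 2 f) ^ 3 by ring, cpU_comb _ _ _ _ hr]
  interval_cases r <;> simp

/-- consequences of the single key identity -/
lemma cpU_phi (o φ : PowerSeries (ZMod 3)) (h : φ = φ ^ 9 + X * (o ^ 24 * φ ^ 9)) (r : ℕ)
    (hr : r < 3) : cpU r φ = if r = 0 then φ ^ 3 else if r = 1 then o ^ 8 * φ ^ 3 else 0 := by
  have := cpU_comb (φ ^ 3) (o ^ 8 * φ ^ 3) 0 r hr
  rw [← this]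
  congr 1
  conv_lhs => rw [h]
  ring

lemma cp_three : (3 : PowerSeries (ZMod 3)) = 0 := by
  have : (3 : ZMod 3) = 0 := by decide
  have h2 : (3 : PowerSeries (ZMod 3)) = C (3 : ZMod 3) := (map_ofNat C 3).symm
  rw [h2, this, map_zero]

lemma cp_fermat (c : ZMod 3) : c ^ 3 = c := by
  revert c; decide

lemma cpU_phi_sq (o φ : PowerSeries (ZMod 3)) (h : φ = φ ^ 9 + X * (o ^ 24 * φ ^ 9)) (r : ℕ)
    (hr : r < 3) : ∃ c : ZMod 3,
      cpU r (φ ^ 2) = C c * (o ^ (8 * r) * φ ^ 6) := by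
  have h1 : φ ^ 2 = (φ ^ 6) ^ 3 + X * (- (o ^ 8 * φ ^ 6)) ^ 3 + X ^ 2 * (o ^ 16 * φ ^ 6) ^ 3 := by
    conv_lhs => rw [h]
    linear_combination (X * o ^ 24 * φ ^ 18) * cp_three
  rw [h1, cpU_comb _ _ _ _ hr]
  interval_cases r
  · exact ⟨1, by simp⟩
  · exact ⟨-1, by simp⟩
  · exact ⟨1, by simp⟩

lemma cpU_cpU_coeff (f : PowerSeries (ZMod 3)) (r s n : ℕ) :
    coeff n (cpU r (cpU s f)) = coeff (9 * n + 3 * r + s) f := by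
  simp only [cpU, coeff_mk]
  rw [show 3 * (3 * n + r) + s = 9 * n + 3 * r + s by ring]

lemma cp_first (o φ A : PowerSeries (ZMod 3)) (h : φ = φ ^ 9 + X * (o ^ 24 * φ ^ 9))
    (hu : IsUnit φ) (j r s : ℕ) (hr : r < 3) (hs : s < 3)
    (hA : A * φ = o ^ (3 * (9 * j + 3 * r + s))) :
    ∃ c : ZMod 3,
      cpU r (cpU s A) = C c * (o ^ (3 * (j + 3 * r + s)) * φ ^ 7) := by
  obtain ⟨c1, h1⟩ := cpU_phi_sq o φ h s hs
  obtain ⟨c2, h2⟩ := cpU_phi_sq o φ h r hr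
  have e1 : φ * cpU s A = o ^ (9 * j + 3 * r + s) * (C c1 * (o ^ (8 * s) * φ ^ 6)) := by
    rw [← cpU_cube_mul _ _ _ hs, ← h1, ← cpU_cube_mul _ _ _ hs]
    congr 1
    linear_combination φ ^ 2 * hA
  have e2 : cpU s A = (C c1 * o ^ (3 * j + r + 3 * s) * φ) ^ 3 * φ ^ 2 := by
    apply hu.mul_left_cancel
    rw [e1]
    have : (C c1 * o ^ (3 * j + r + 3 * s) * φ) ^ 3 = C c1 * (o ^ (3 * j + r + 3 * s) * φ) ^ 3 := by
      rw [mul_assoc, mul_pow, ← map_pow, cp_fermat c1]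
    rw [this]; ring
  refine ⟨c1 * c2, ?_⟩
  rw [e2, cpU_cube_mul _ _ _ hr, h2, map_mul]
  ring

lemma cp_iter (o φ : PowerSeries (ZMod 3)) (h : φ = φ ^ 9 + X * (o ^ 24 * φ ^ 9))
    (r s : ℕ) (hr : r < 3) (hs : s < 3) :
    ∃ c : ZMod 3,
      cpU r (cpU s (o ^ (3 * (3 * r + s)) * φ ^ 7)) = C c * (o ^ (3 * (3 * r + s)) * φ ^ 7) := by
  obtain ⟨c2, h2⟩ := cpU_phi_sq o φ h r hr
  have e0 : o ^ (3 * (3 * r + s)) * φ ^ 7 = (o ^ (3 * r + s) * φ ^ 2) ^ 3 * φ := by ring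
  rw [e0, cpU_cube_mul _ _ _ hs, cpU_phi o φ h s hs]
  interval_cases s
  · refine ⟨c2, ?_⟩
    simp only [if_true]
    rw [show o ^ (3 * r + 0) * φ ^ 2 * φ ^ 3 = (o ^ r * φ) ^ 3 * φ ^ 2 by ring, cpU_cube_mul _ _ _ hr, h2]
    ring
  · refine ⟨c2, ?_⟩
    simp only [if_true, one_ne_zero, if_false]
    rw [show o ^ (3 * r + 1) * φ ^ 2 * (o ^ 8 * φ ^ 3) = (o ^ (r + 3) * φ) ^ 3 * φ ^ 2 by ring,
      cpU_cube_mul _ _ _ hr, h2]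
    ring
  · refine ⟨0, ?_⟩
    ext n; simp [cpU]

lemma cp_vanish (o φ : PowerSeries (ZMod 3)) (h : φ = φ ^ 9 + X * (o ^ 24 * φ ^ 9)) (b : ℕ) :
    cpU 2 (o ^ (3 * b) * φ ^ 7) = 0 := by
  rw [show o ^ (3 * b) * φ ^ 7 = (o ^ b * φ ^ 2) ^ 3 * φ by ring, cpU_cube_mul _ _ _ (by norm_num),
    cpU_phi o φ h 2 (by norm_num)]
  simp

section Shanks
variable {R : Type*} [CommRing R] (q : R)

/-- `∏_{s ≤ j < n} (1 - q^(j+1))`-type products and Shanks' finite identity for squares. -/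
lemma cp_shanks_phi_aux (n m : ℕ) (hm : m ≤ n) :
    (∏ j ∈ Finset.Ico 0 n, (1 - q ^ (j + 1))) * (1 - q ^ (n + 1))
      + 2 * ∑ s ∈ Finset.range m, (-1) ^ (s + 1) * q ^ ((s + 1) * (n + 2)) *
        (∏ j ∈ Finset.range s, (1 + q ^ (j + 1))) *
        (∏ j ∈ Finset.Ico (s + 1) n, (1 - q ^ (j + 1))) * (1 - q ^ (n + 1))
      - (1 + q ^ (n + 1)) * ((∏ j ∈ Finset.Ico 0 n, (1 - q ^ (j + 1)))
      + 2 * ∑ s ∈ Finset.range m, (-1) ^ (s + 1) * q ^ ((s + 1) * (n + 1)) *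
        (∏ j ∈ Finset.range s, (1 + q ^ (j + 1))) *
        (∏ j ∈ Finset.Ico (s + 1) n, (1 - q ^ (j + 1))))
      = 2 * (-1) ^ (m + 1) * q ^ ((m + 1) * (n + 1)) *
        (∏ j ∈ Finset.range m, (1 + q ^ (j + 1))) *
        (∏ j ∈ Finset.Ico m n, (1 - q ^ (j + 1))) := by
  induction m with
  | zero => simp; ring
  | succ m ih =>
    have ih := ih (by omega)
    rw [Finset.sum_range_succ, Finset.sum_range_succ, Finset.prod_range_succ]
    rw [Finset.prod_eq_prod_Ico_succ_bot (show m < n by omega)] at ih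
    linear_combination ih

lemma cp_shanks_phi (n : ℕ) :
    (∏ j ∈ Finset.range n, (1 + q ^ (j + 1))) *
      (1 + 2 * ∑ s ∈ Finset.range n, (-1) ^ (s + 1) * q ^ ((s + 1) ^ 2))
    = (∏ j ∈ Finset.range n, (1 - q ^ (j + 1)))
      + 2 * ∑ s ∈ Finset.range n, (-1) ^ (s + 1) * q ^ ((s + 1) * (n + 1)) *
        (∏ j ∈ Finset.range s, (1 + q ^ (j + 1))) *
        (∏ j ∈ Finset.Ico (s + 1) n, (1 - q ^ (j + 1))) := by
  induction n with
  | zero => simp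
  | succ n ih =>
    have h := cp_shanks_phi_aux q n n le_rfl
    rw [Finset.Ico_self, Finset.prod_empty] at h
    rw [← Finset.range_eq_Ico] at h
    have hs : ∑ s ∈ Finset.range n, (-1) ^ (s + 1) * q ^ ((s + 1) * (n + 1 + 1)) *
        (∏ j ∈ Finset.range s, (1 + q ^ (j + 1))) *
        (∏ j ∈ Finset.Ico (s + 1) (n + 1), (1 - q ^ (j + 1))) =
        ∑ s ∈ Finset.range n, (-1) ^ (s + 1) * q ^ ((s + 1) * (n + 2)) *
        (∏ j ∈ Finset.range s, (1 + q ^ (j + 1))) *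
        (∏ j ∈ Finset.Ico (s + 1) n, (1 - q ^ (j + 1))) * (1 - q ^ (n + 1)) := by
      refine Finset.sum_congr rfl fun s hs => ?_
      have := Finset.mem_range.1 hs
      rw [Finset.prod_Ico_succ_top (by omega)]
      ring
    rw [Finset.prod_range_succ, Finset.sum_range_succ, Finset.prod_range_succ,
      Finset.sum_range_succ, hs, Finset.Ico_self, Finset.prod_empty]
    linear_combination (1 + q ^ (n + 1)) * ih - h

lemma cp_shanks_psi_aux (n m : ℕ) (hm : m ≤ n) :
    ∑ s ∈ Finset.range (m + 1), q ^ (s * (2 * n + 3)) *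
        (∏ j ∈ Finset.range s, (1 - q ^ (2 * j + 1))) *
        (∏ j ∈ Finset.Ico s n, (1 - q ^ (2 * j + 2))) * (1 - q ^ (2 * n + 2))
      - (1 - q ^ (2 * n + 1)) * ∑ s ∈ Finset.range (m + 1), q ^ (s * (2 * n + 1)) *
        (∏ j ∈ Finset.range s, (1 - q ^ (2 * j + 1))) *
        (∏ j ∈ Finset.Ico s n, (1 - q ^ (2 * j + 2)))
      = q ^ ((m + 1) * (2 * n + 1)) *
        (∏ j ∈ Finset.range (m + 1), (1 - q ^ (2 * j + 1))) *
        (∏ j ∈ Finset.Ico m n, (1 - q ^ (2 * j + 2))) := by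
  induction m with
  | zero => simp; ring
  | succ m ih =>
    have ih := ih (by omega)
    rw [Finset.sum_range_succ _ (m + 1), Finset.sum_range_succ _ (m + 1),
      Finset.prod_range_succ _ (m + 1)]
    rw [Finset.prod_eq_prod_Ico_succ_bot (show m < n by omega)] at ih
    linear_combination ih

lemma cp_shanks_psi (n : ℕ) :
    (∏ j ∈ Finset.range n, (1 - q ^ (2 * j + 1))) *
      (∑ s ∈ Finset.range (2 * n + 1), q ^ (s * (s + 1) / 2))
    = ∑ s ∈ Finset.range (n + 1), q ^ (s * (2 * n + 1)) *
        (∏ j ∈ Finset.range s, (1 - q ^ (2 * j + 1))) *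
        (∏ j ∈ Finset.Ico s n, (1 - q ^ (2 * j + 2))) := by
  induction n with
  | zero => simp
  | succ n ih =>
    have h := cp_shanks_psi_aux q n n le_rfl
    rw [Finset.Ico_self, Finset.prod_empty] at h
    have hs : ∑ s ∈ Finset.range (n + 1), q ^ (s * (2 * (n + 1) + 1)) *
        (∏ j ∈ Finset.range s, (1 - q ^ (2 * j + 1))) *
        (∏ j ∈ Finset.Ico s (n + 1), (1 - q ^ (2 * j + 2))) =
        ∑ s ∈ Finset.range (n + 1), q ^ (s * (2 * n + 3)) *
        (∏ j ∈ Finset.range s, (1 - q ^ (2 * j + 1))) *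
        (∏ j ∈ Finset.Ico s n, (1 - q ^ (2 * j + 2))) * (1 - q ^ (2 * n + 2)) := by
      refine Finset.sum_congr rfl fun s hs => ?_
      have := Finset.mem_range.1 hs
      rw [Finset.prod_Ico_succ_top (by omega)]
      ring
    rw [show 2 * (n + 1) + 1 = (2 * n + 1) + 1 + 1 by ring, Finset.sum_range_succ,
      Finset.sum_range_succ, show (2 * n + 1) + 1 + 1 = 2 * (n + 1) + 1 by ring,
      Finset.sum_range_succ _ (n + 1), hs, Finset.Ico_self, Finset.prod_empty,
      Finset.prod_range_succ]
    rw [Finset.prod_range_succ] at h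
    have e1 : (2 * n + 1) * (2 * n + 1 + 1) / 2 = (n + 1) * (2 * n + 1) := by
      rw [show (2 * n + 1) * (2 * n + 1 + 1) = ((n + 1) * (2 * n + 1)) * 2 by ring]; simp
    have e2 : (2 * n + 2) * (2 * (n + 1) + 1) / 2 = (n + 1) * (2 * (n + 1) + 1) := by
      rw [show (2 * n + 2) * (2 * (n + 1) + 1) = ((n + 1) * (2 * (n + 1) + 1)) * 2 by ring]; simp
    rw [e1, e2]
    linear_combination (1 - q ^ (2 * n + 1)) * ih - h

end Shanks

section Theta
open PowerSeries.WithPiTopology Filter Topology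

/-- `∑_{n ∈ ℤ} (-1)^n q^{n²}` -/
noncomputable def cpPhi : PowerSeries (ZMod 3) :=
  PowerSeries.mk fun N => if IsSquare N then (if N = 0 then 1 else 2 * (-1) ^ N) else 0

/-- `∑_{n ≥ 0} q^{n(n+1)/2}` -/
noncomputable def cpPsi : PowerSeries (ZMod 3) :=
  PowerSeries.mk fun N => if IsSquare (8 * N + 1) then 1 else 0

lemma cp_tendsto (F : ℕ → PowerSeries (ZMod 3)) (L : PowerSeries (ZMod 3))
    (h : ∀ n d, d < n → coeff d (F n) = coeff d L) : Tendsto F atTop (𝓝 L) := by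
  rw [tendsto_iff_coeff_tendsto]
  intro d
  exact tendsto_atTop_of_eventually_const (i₀ := d + 1) fun n hn => h n d hn

lemma cp_sq_mul_nine (M : ℕ) : IsSquare (9 * M) ↔ IsSquare M := by
  constructor
  · rintro ⟨r, hr⟩
    have : 3 ∣ r := by
      have : 3 ∣ r * r := ⟨3 * M, by omega⟩
      rcases (Nat.Prime.dvd_mul Nat.prime_three).1 this with h | h <;> exact h
    obtain ⟨s, rfl⟩ := this
    exact ⟨s, by nlinarith⟩
  · rintro ⟨r, rfl⟩
    exact ⟨3 * r, by ring⟩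

lemma cp_sq_three (N : ℕ) (h : IsSquare (3 * N)) : 3 ∣ N := by
  obtain ⟨r, hr⟩ := h
  have : 3 ∣ r := by
    have : 3 ∣ r * r := ⟨N, by omega⟩
    rcases (Nat.Prime.dvd_mul Nat.prime_three).1 this with h | h <;> exact h
  obtain ⟨s, rfl⟩ := this
  exact ⟨s * s, by nlinarith⟩

lemma cpU_zero_phi : cpU 0 cpPhi = cpPhi ^ 3 := by
  ext N
  rw [cp_cube, coeff_expand, cpU, coeff_mk, add_zero]
  by_cases h : 3 ∣ N
  · obtain ⟨M, rfl⟩ := h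
    rw [if_pos (by omega), show 3 * M / 3 = M by omega, show 3 * (3 * M) = 9 * M by ring]
    simp only [cpPhi, coeff_mk, cp_sq_mul_nine]
    rw [pow_mul]
    norm_num
  · rw [if_neg h]
    simp only [cpPhi, coeff_mk]
    rw [if_neg (fun h' => h (cp_sq_three N h'))]

lemma cpU_two_phi : cpU 2 cpPhi = 0 := by
  ext N
  simp only [cpU, cpPhi, coeff_mk, map_zero]
  rw [if_neg]
  rintro ⟨r, hr⟩
  have h1 : r * r % 3 = 2 := by omega
  have : r % 3 < 3 := Nat.mod_lt _ (by norm_num)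
  rw [Nat.mul_mod] at h1
  interval_cases r % 3 <;> omega

lemma cpU_one_psi : cpU 1 cpPsi = cpPsi ^ 3 := by
  ext N
  rw [cp_cube, coeff_expand, cpU, coeff_mk]
  by_cases h : 3 ∣ N
  · obtain ⟨M, rfl⟩ := h
    rw [if_pos (by omega), show 3 * M / 3 = M by omega]
    simp only [cpPsi, coeff_mk]
    rw [show 8 * (3 * (3 * M) + 1) + 1 = 9 * (8 * M + 1) by ring]
    simp only [cp_sq_mul_nine]
  · rw [if_neg h]
    simp only [cpPsi, coeff_mk]
    rw [if_neg]
    intro h'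
    rw [show 8 * (3 * N + 1) + 1 = 3 * (8 * N + 3) by ring] at h'
    have := cp_sq_three _ h'
    omega

lemma cp_key (o : PowerSeries (ZMod 3)) (ho : IsUnit o) (h : cpPsi = o ^ 3 * cpPhi) :
    cpPhi = cpPhi ^ 9 + X * (o ^ 24 * cpPhi ^ 9) := by
  have h1 : o * cpU 1 cpPhi = cpPsi ^ 3 := by
    rw [← cpU_cube_mul _ _ _ (by norm_num), ← h, cpU_one_psi]
  have h2 : cpU 1 cpPhi = o ^ 8 * cpPhi ^ 3 := by
    apply ho.mul_left_cancel
    rw [h1, h]; ring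
  conv_lhs => rw [cp_decomp cpPhi, cpU_zero_phi, cpU_two_phi, h2]
  ring

lemma cp_phi_partial : Tendsto (fun n => 1 + 2 * ∑ s ∈ Finset.range n,
    (-1) ^ (s + 1) * (X : PowerSeries (ZMod 3)) ^ ((s + 1) ^ 2)) atTop (𝓝 cpPhi) := by
  apply cp_tendsto
  intro n d hd
  have e : ∀ s : ℕ, coeff d ((-1) ^ (s + 1) * (X : PowerSeries (ZMod 3)) ^ ((s + 1) ^ 2)) =
      if d = (s + 1) ^ 2 then (-1) ^ (s + 1) else 0 := by
    intro s
    rw [show ((-1) ^ (s + 1) : PowerSeries (ZMod 3)) = C ((-1) ^ (s + 1)) by simp, coeff_C_mul,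
      coeff_X_pow]
    simp
  rw [map_add, show (2 : PowerSeries (ZMod 3)) = C 2 from (map_ofNat C 2).symm, coeff_C_mul, map_sum]
  simp only [e, cpPhi, coeff_mk, coeff_one]
  by_cases hsq : IsSquare d
  · rw [if_pos hsq]
    obtain ⟨r, rfl⟩ := hsq
    rcases r with _ | r
    · rw [Finset.sum_eq_zero]
      · simp
      · intro s _
        rw [if_neg]
        have : 0 < (s + 1) ^ 2 := by positivity
        omega
    · rw [Finset.sum_eq_single r]
      · have hne : (r + 1) * (r + 1) ≠ 0 := by positivity
        rw [if_neg hne, if_neg hne, if_pos (by ring), zero_add]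
        congr 1
        rw [pow_mul]
        rcases Nat.even_or_odd (r + 1) with h | h
        · rw [h.neg_one_pow, one_pow]
        · rw [h.neg_one_pow, h.neg_one_pow]
      · intro b _ hb
        rw [if_neg]
        intro h
        apply hb
        have : r + 1 = b + 1 := by nlinarith [Nat.pow_left_injective (n := 2) (by norm_num) (show (fun i => i ^ 2) (r + 1) = (fun i => i ^ 2) (b + 1) by simp only; rw [← h]; ring)]
        omega
      · intro h
        exfalso
        apply h
        rw [Finset.mem_range]
        nlinarith
  · rw [if_neg hsq, Finset.sum_eq_zero, if_neg]
    · simp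
    · rintro rfl; exact hsq ⟨0, rfl⟩
    · intro s _
      rw [if_neg]
      rintro rfl
      exact hsq ⟨s + 1, by ring⟩

lemma cp_psi_partial : Tendsto (fun n => ∑ s ∈ Finset.range (2 * n + 1),
    (X : PowerSeries (ZMod 3)) ^ (s * (s + 1) / 2)) atTop (𝓝 cpPsi) := by
  apply cp_tendsto
  intro n d hd
  rw [map_sum]
  simp only [coeff_X_pow, cpPsi, coeff_mk]
  have key : ∀ s, d = s * (s + 1) / 2 ↔ 8 * d + 1 = (2 * s + 1) * (2 * s + 1) := by
    intro s
    have := Nat.div_mul_cancel (Nat.even_mul_succ_self s).two_dvd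
    constructor
    · intro h
      rw [← h] at this
      nlinarith
    · intro h
      nlinarith
  by_cases hsq : IsSquare (8 * d + 1)
  · rw [if_pos hsq]
    obtain ⟨r, hr⟩ := hsq
    have hodd : r % 2 = 1 := by
      rcases Nat.mod_two_eq_zero_or_one r with h | h
      · obtain ⟨k, rfl⟩ := Nat.dvd_of_mod_eq_zero h
        have : 2 * k * (2 * k) = 2 * (k * (2 * k)) := by ring
        omega
      · exact h
    obtain ⟨s, rfl⟩ : ∃ s, r = 2 * s + 1 := ⟨r / 2, by omega⟩
    rw [Finset.sum_eq_single s]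
    · rw [if_pos ((key s).2 hr)]
    · intro b _ hb
      rw [if_neg]
      intro h
      have := (key b).1 h
      rw [hr] at this
      have := Nat.mul_self_inj.1 this
      omega
    · intro h
      exfalso
      apply h
      rw [Finset.mem_range]
      nlinarith
  · rw [if_neg hsq, Finset.sum_eq_zero]
    intro s _
    rw [if_neg]
    intro h
    exact hsq ⟨2 * s + 1, (key s).1 h⟩

lemma cp_tendsto_zero_of_dvd (F : ℕ → PowerSeries (ZMod 3)) (h : ∀ n, X ^ n ∣ F n) :
    Tendsto F atTop (𝓝 0) := by
  apply cp_tendsto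
  intro n d hd
  rw [map_zero]
  exact X_pow_dvd_iff.1 (h n) d hd

lemma cp_gauss_phi (o f : PowerSeries (ZMod 3)) (ho : HasProd (fun i => 1 + X ^ (i + 1)) o)
    (hf : HasProd (fun i => 1 - X ^ (i + 1)) f) : o * cpPhi = f := by
  have h1 := (ho.tendsto_prod_nat).mul cp_phi_partial
  have h2 : Tendsto (fun n => 2 * ∑ s ∈ Finset.range n, (-1) ^ (s + 1) *
      (X : PowerSeries (ZMod 3)) ^ ((s + 1) * (n + 1)) *
        (∏ j ∈ Finset.range s, (1 + X ^ (j + 1))) *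
        (∏ j ∈ Finset.Ico (s + 1) n, (1 - X ^ (j + 1)))) atTop (𝓝 0) := by
    apply cp_tendsto_zero_of_dvd
    intro n
    apply Dvd.dvd.mul_left
    apply Finset.dvd_sum
    intro s _
    apply Dvd.dvd.mul_right
    apply Dvd.dvd.mul_right
    apply Dvd.dvd.mul_left
    exact pow_dvd_pow _ (by nlinarith)
  have h3 := (hf.tendsto_prod_nat).add h2
  rw [add_zero] at h3
  refine tendsto_nhds_unique h1 (h3.congr fun n => ?_)
  exact (cp_shanks_phi X n).symm

lemma cp_gauss_psi (d e : PowerSeries (ZMod 3)) (hd : HasProd (fun i => 1 - X ^ (2 * i + 1)) d)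
    (he : HasProd (fun i => 1 - X ^ (2 * i + 2)) e) : d * cpPsi = e := by
  have h1 := (hd.tendsto_prod_nat).mul cp_psi_partial
  have h2 : Tendsto (fun n => ∑ s ∈ Finset.range n,
      (X : PowerSeries (ZMod 3)) ^ ((s + 1) * (2 * n + 1)) *
        (∏ j ∈ Finset.range (s + 1), (1 - X ^ (2 * j + 1))) *
        (∏ j ∈ Finset.Ico (s + 1) n, (1 - X ^ (2 * j + 2)))) atTop (𝓝 0) := by
    apply cp_tendsto_zero_of_dvd
    intro n
    apply Finset.dvd_sum
    intro s _
    apply Dvd.dvd.mul_right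
    apply Dvd.dvd.mul_right
    exact pow_dvd_pow _ (by nlinarith)
  have h3 := h2.add (he.tendsto_prod_nat)
  rw [zero_add] at h3
  refine tendsto_nhds_unique h1 (h3.congr fun n => ?_)
  rw [cp_shanks_psi X n, Finset.sum_range_succ']
  simp only [zero_mul, pow_zero, one_mul, Finset.range_zero, Finset.prod_empty,
    ← Finset.range_eq_Ico]

/-- generating function of ordinary partitions -/
noncomputable def cpP : PowerSeries (ZMod 3) :=
  PowerSeries.mk fun n => ((Nat.Partition.restricted n (fun _ => True)).card : ZMod 3)

/-- generating function of partitions into odd parts -/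
noncomputable def cpO : PowerSeries (ZMod 3) :=
  PowerSeries.mk fun n => ((Nat.Partition.restricted n (¬ 2 ∣ ·)).card : ZMod 3)

lemma cp_hasProd_O : HasProd (fun i => 1 + (X : PowerSeries (ZMod 3)) ^ (i + 1)) cpO := by
  have h := Nat.Partition.hasProd_powerSeriesMk_card_countRestricted (ZMod 3) (m := 2) (by norm_num)
  rw [← Nat.Partition.powerSeriesMk_card_restricted_eq_powerSeriesMk_card_countRestricted
    (ZMod 3) (by norm_num)] at h
  refine h.congr_fun fun i => ?_
  simp [Finset.sum_range_succ]

lemma cp_mul_order (a : ℕ → ℕ) (ha : ∀ n, n ≤ a n) :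
    Multipliable fun i => 1 - (X : PowerSeries (ZMod 3)) ^ (a i + 1) := by
  simp_rw [sub_eq_add_neg]
  apply multipliable_one_add_of_tendsto_order_atTop_nhds_top
  refine ENat.tendsto_nhds_top_iff_natCast_lt.mpr (fun n ↦ Filter.eventually_atTop.mpr ⟨n, ?_⟩)
  intro m hm
  rw [order_neg, order_X_pow]
  norm_cast
  have := ha m
  omega

lemma cp_relations : ∃ f : PowerSeries (ZMod 3), cpP * f = 1 ∧ cpO * cpPhi = f ∧
    cpPsi = cpO ^ 2 * f ∧ IsUnit cpO := by
  obtain ⟨f, hf⟩ := cp_mul_order (fun i => i) (fun n => le_rfl)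
  obtain ⟨d, hd⟩ := cp_mul_order (fun i => 2 * i) (fun n => by omega)
  obtain ⟨e, he⟩ := cp_mul_order (fun i => 2 * i + 1) (fun n => by omega)
  have h1 := cp_gauss_phi cpO f cp_hasProd_O hf
  have h2 := cp_gauss_psi d e hd he
  have h3 : d * e = f := by
    refine (HasProd.even_mul_odd (f := fun i => 1 - (X : PowerSeries (ZMod 3)) ^ (i + 1)) hd he).unique hf
  have h4 : cpO * f = e := by
    refine HasProd.unique (cp_hasProd_O.mul hf) ?_
    convert he using 2 with i
    ring
  have hp : cpP * f = 1 := by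
    have hP := Nat.Partition.hasProd_powerSeriesMk_card_restricted (ZMod 3) (fun _ => True)
    have := hP.mul hf
    refine HasProd.unique this ?_
    convert hasProd_one using 2 with i
    rw [if_pos trivial]
    simp_rw [pow_mul]
    exact tsum_pow_mul_one_sub_of_constantCoeff_eq_zero (by simp)
  have hfu : IsUnit f := IsUnit.of_mul_eq_one_right _ hp
  have h5 : cpO * d = 1 := by
    apply (hfu.mul_left_cancel)
    linear_combination d * h4 + h3
  refine ⟨f, hp, h1, ?_, IsUnit.of_mul_eq_one _ h5⟩
  linear_combination (-cpPsi) * h5 + cpO * h2 - cpO * h4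

end Theta

section Comb
open Finset

/-- predicate on the parts of the `i`-th partition -/
def cpPred (i : ℕ) : ℕ → Prop := fun x => i ≠ 0 → ¬ 2 ∣ x

noncomputable instance (i : ℕ) : DecidablePred (cpPred i) := fun _ => Classical.dec _

/-- multisets of parts of restricted partitions -/
noncomputable def cpS (i m : ℕ) : Finset (Multiset ℕ) :=
  (Nat.Partition.restricted m (cpPred i)).image (fun p => p.parts)

lemma cpS_card (i m : ℕ) : (cpS i m).card = (Nat.Partition.restricted m (cpPred i)).card := by
  apply Finset.card_image_of_injective
  intro p q h
  exact Nat.Partition.ext h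

lemma mem_cpS (i m : ℕ) (s : Multiset ℕ) :
    s ∈ cpS i m ↔ (∀ x ∈ s, 0 < x) ∧ (i ≠ 0 → ∀ x ∈ s, Odd x) ∧ s.sum = m := by
  have hm : ∀ p : m.Partition, p ∈ Nat.Partition.restricted m (cpPred i) ↔
      ∀ x ∈ p.parts, i ≠ 0 → ¬ 2 ∣ x := by
    intro p
    rw [Nat.Partition.restricted, Finset.mem_filter]
    simp only [Finset.mem_univ, true_and, cpPred]
  simp only [cpS, Finset.mem_image, hm]
  constructor
  · rintro ⟨p, hp, rfl⟩
    refine ⟨fun x hx => p.parts_pos hx, fun hi x hx => ?_, p.parts_sum⟩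
    have := hp x hx hi
    rw [← Nat.not_even_iff_odd, even_iff_two_dvd]
    exact this
  · rintro ⟨h1, h2, h3⟩
    refine ⟨⟨s, fun {x} hx => h1 x hx, h3⟩, fun x hx hi => ?_, rfl⟩
    rw [← even_iff_two_dvd, Nat.not_even_iff_odd]
    exact h2 hi x hx

lemma cp_count (k n : ℕ) : coloredPartition k n =
    ∑ l ∈ finsuppAntidiag (univ : Finset (Fin k)) n, ∏ i : Fin k, (cpS i (l i)).card := by
  have hset : {c : Fin k → Multiset ℕ |
    (∀ i, ∀ x ∈ c i, 0 < x) ∧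
    (∀ i : Fin k, i.val ≠ 0 → ∀ x ∈ c i, Odd x) ∧
    (∑ i, (c i).sum) = n} = (((finsuppAntidiag (univ : Finset (Fin k)) n).biUnion
      fun l => Fintype.piFinset fun i : Fin k => cpS i (l i) : Finset (Fin k → Multiset ℕ)) :
        Set (Fin k → Multiset ℕ)) := by
    ext c
    simp only [Set.mem_ofPred_eq, Finset.coe_biUnion, Set.mem_iUnion, Finset.mem_coe,
      Fintype.mem_piFinset, mem_cpS, Finset.mem_finsuppAntidiag, exists_prop]
    constructor
    · rintro ⟨h1, h2, h3⟩
      refine ⟨Finsupp.equivFunOnFinite.symm (fun i => (c i).sum), ⟨?_, by simp⟩, ?_⟩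
      · simpa using h3
      · intro i
        exact ⟨h1 i, h2 i, by simp⟩
    · rintro ⟨l, ⟨h1, _⟩, h2⟩
      refine ⟨fun i => (h2 i).1, fun i => (h2 i).2.1, ?_⟩
      rw [← h1]
      exact Finset.sum_congr rfl fun i _ => (h2 i).2.2
  rw [coloredPartition, hset, Set.ncard_coe_finset, Finset.card_biUnion]
  · simp [Fintype.card_piFinset]
  · intro l _ l' _ hne
    rw [Function.onFun, Finset.disjoint_left]
    intro c hc hc'
    apply hne
    ext i
    rw [Fintype.mem_piFinset] at hc hc'
    have h1 := ((mem_cpS _ _ _).1 (hc i)).2.2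
    have h2 := ((mem_cpS _ _ _).1 (hc' i)).2.2
    omega

lemma cp_genfun (k : ℕ) :
    (PowerSeries.mk fun n => (coloredPartition (k + 1) n : ZMod 3)) = cpP * cpO ^ k := by
  have h0 : (PowerSeries.mk fun n => ((cpS 0 n).card : ZMod 3)) = cpP := by
    ext n
    simp only [cpP, coeff_mk, cpS_card]
    congr 2
    ext p
    simp [Nat.Partition.restricted, cpPred]
  have h1 : ∀ i, i ≠ 0 → (PowerSeries.mk fun n => ((cpS i n).card : ZMod 3)) = cpO := by
    intro i hi
    ext n
    simp only [cpO, coeff_mk, cpS_card]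
    congr 2
    ext p
    simp [Nat.Partition.restricted, cpPred, hi]
  have h2 : (PowerSeries.mk fun n => (coloredPartition (k + 1) n : ZMod 3)) =
      ∏ i : Fin (k + 1), (PowerSeries.mk fun n => ((cpS i n).card : ZMod 3)) := by
    ext n
    rw [coeff_prod, coeff_mk, cp_count]
    push_cast
    simp
  rw [h2, Fin.prod_univ_succ]
  simp only [Fin.val_zero, h0]
  rw [Finset.prod_congr rfl (fun i _ => h1 _ (by simp))]
  simp

lemma cp_main_identity (a : ℕ) :
    (PowerSeries.mk fun n => (coloredPartition (3 * a + 2) n : ZMod 3)) * cpPhi =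
      cpO ^ (3 * a) := by
  obtain ⟨f, h1, h2, h3, hO⟩ := cp_relations
  rw [cp_genfun (3 * a + 1)]
  linear_combination cpO ^ (3 * a) * h1 + cpP * cpO ^ (3 * a) * h2

lemma cp_main_key : cpPhi = cpPhi ^ 9 + X * (cpO ^ 24 * cpPhi ^ 9) := by
  obtain ⟨f, h1, h2, h3, hO⟩ := cp_relations
  apply cp_key _ hO
  rw [h3, ← h2]; ring

lemma cp_phi_unit : IsUnit cpPhi := by
  obtain ⟨f, h1, h2, h3, hO⟩ := cp_relations
  refine IsUnit.of_mul_eq_one (cpP * cpO) ?_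
  rw [← h1, ← h2]; ring

lemma cp_series_vanish (b n k e : ℕ) (hb : b ≤ 8) (he : 9 ^ k = 8 * e + 1) :
    coeff (9 ^ k * (3 * n + 2) + b * e) (cpO ^ (3 * b) * cpPhi ^ 7) = 0 := by
  induction k generalizing e with
  | zero =>
    obtain rfl : e = 0 := by omega
    have := cp_vanish cpO cpPhi cp_main_key b
    have := congrArg (coeff n) this
    simpa [cpU] using this
  | succ k ih =>
    obtain ⟨e', he'⟩ : ∃ e', 9 ^ k = 8 * e' + 1 := by
      refine ⟨e / 9, ?_⟩
      rw [pow_succ] at he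
      omega
    have hee : e = 9 * e' + 1 := by rw [pow_succ] at he; omega
    have ih := ih e' he'
    obtain ⟨r, s, hr, hs, hbs⟩ : ∃ r s, r < 3 ∧ s < 3 ∧ b = 3 * r + s :=
      ⟨b / 3, b % 3, by omega, by omega, by omega⟩
    obtain ⟨c, hc⟩ := cp_iter cpO cpPhi cp_main_key r s hr hs
    rw [← hbs] at hc
    have h := congrArg (coeff (9 ^ k * (3 * n + 2) + b * e')) hc
    rw [cpU_cpU_coeff, coeff_C_mul, ih, mul_zero] at h
    rw [← h]
    congr 2
    rw [hee, pow_succ, hbs]; ring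

end Comb

/-- Main theorem: for each admissible `α = 9j + t` in the given list and all `n, k ≥ 0`,
`a_{3α+2}(3^(2k+3) n + 9^k (18 + t) + α (9^k − 1)/8) ≡ 0 (mod 3)`. -/
theorem coloredPartition_main_congr (α j t n k : ℕ)
    (hα : α ∈ ({1, 3, 4, 6, 7, 9, 11, 12, 14, 15, 20, 22, 23, 27, 28, 30, 31, 36, 38, 39,
      46, 47, 54, 55, 63} : Finset ℕ))
    (hjt : α = 9 * j + t) (ht : t ≤ 8) :
    3 ∣ coloredPartition (3 * α + 2)
      (3 ^ (2 * k + 3) * n + 9 ^ k * (18 + t) + α * (9 ^ k - 1) / 8) := by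
  have hb : j + t ≤ 8 := by
    simp only [Finset.mem_insert, Finset.mem_singleton] at hα
    omega
  obtain ⟨e, he⟩ : ∃ e, 9 ^ k = 8 * e + 1 := by
    have h : 9 ^ k % 8 = 1 := by
      rw [Nat.pow_mod]; simp
    exact ⟨9 ^ k / 8, by omega⟩
  have hN : 3 ^ (2 * k + 3) * n + 9 ^ k * (18 + t) + α * (9 ^ k - 1) / 8 =
      9 * (9 ^ k * (3 * n + 2) + (j + t) * e) + t := by
    have h3 : 3 ^ (2 * k + 3) = 27 * 9 ^ k := by
      rw [pow_add, pow_mul]; norm_num; ring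
    have h4 : α * (9 ^ k - 1) / 8 = α * e := by
      rw [he, Nat.add_sub_cancel, show α * (8 * e) = (α * e) * 8 by ring]; simp
    rw [h3, h4, hjt, he]; ring
  obtain ⟨r, s, hr, hs, hts⟩ : ∃ r s, r < 3 ∧ s < 3 ∧ t = 3 * r + s :=
    ⟨t / 3, t % 3, by omega, by omega, by omega⟩
  have hA := cp_main_identity α
  rw [show 3 * α = 3 * (9 * j + 3 * r + s) by omega] at hA
  obtain ⟨c, hc⟩ := cp_first cpO cpPhi _ cp_main_key cp_phi_unit j r s hr hs hA
  have h := congrArg (coeff (9 ^ k * (3 * n + 2) + (j + t) * e)) hc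
  rw [cpU_cpU_coeff, coeff_C_mul, show j + 3 * r + s = j + t by omega,
    cp_series_vanish (j + t) n k e hb he, mul_zero, coeff_mk,
    ZMod.natCast_eq_zero_iff] at h
  rw [hN, show 3 * α = 3 * (9 * j + 3 * r + s) by omega]
  rw [show 9 * (9 ^ k * (3 * n + 2) + (j + t) * e) + t =
    9 * (9 ^ k * (3 * n + 2) + (j + t) * e) + 3 * r + s by rw [add_assoc, ← hts]]
  exact h
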